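/- Let p be a prime, q = p^m, and let K be a field of characteristic p containing F_q, complete with respect to a nonarchimedean multiplicative norm |·|. For t ∈ K^* define in PGL(2,K) the elements ε_u (class of [[1,u],[0,1]]) for u ∈ F_q, τ_t (class of [[0,t],[1,0]]), ε'_{u,t} = τ_t ε_u τ_t, δ_{u,v,t} = ε_u ε'_{v,t} ε_u^{−1} ε'_{v,t}^{−1}, and let Γ(t) ≤ PGL(2,K) be the subgroup generated by {δ_{u,v,t} : u,v ∈ F_q}. Let t₁, t₂ ∈ K with 0 < |t₁| < 1 and 0 < |t₂| < 1. Then Γ(t₁) and Γ(t₂) are conjugate subgroups of PGL(2,K) if and only if t₁ = ζ t₂ for some nonzero ζ ∈ F_q. -/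

import Mathlib

open scoped Classical

/-- The projective general linear group `PGL(2,K)`: the quotient of `GL(2,K)` by its center
(the nonzero scalar matrices). -/
abbrev PGL2 (K : Type*) [Field K] :=
  Matrix.GeneralLinearGroup (Fin 2) K ⧸
    Subgroup.center (Matrix.GeneralLinearGroup (Fin 2) K)

/-- The class in `PGL(2,K)` of a 2×2 matrix with nonzero determinant. -/
noncomputable def pgl2 {K : Type*} [Field K] (A : Matrix (Fin 2) (Fin 2) K)
    (h : A.det ≠ 0) : PGL2 K :=
  QuotientGroup.mk (Matrix.GeneralLinearGroup.mkOfDetNeZero A h)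

/-- `ε_c`: the class in `PGL(2,K)` of the matrix `[[1, c], [0, 1]]`. -/
noncomputable def eps {K : Type*} [Field K] (c : K) : PGL2 K :=
  pgl2 !![1, c; 0, 1] (by simp [Matrix.det_fin_two_of])

/-- `τ_t`: the class in `PGL(2,K)` of the matrix `[[0, t], [1, 0]]` (junk value `1` when
`t = 0`). -/
noncomputable def tau {K : Type*} [Field K] (t : K) : PGL2 K :=
  if h : t = 0 then 1 else pgl2 !![0, t; 1, 0] (by simp [Matrix.det_fin_two_of, h])

/-- `ε'_{c,t} = τ_t ε_c τ_t`: the class in `PGL(2,K)` of the matrix `[[t, 0], [c, t]]`. -/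
noncomputable def eps' {K : Type*} [Field K] (c t : K) : PGL2 K :=
  tau t * eps c * tau t

/-- `δ_{u,v,t}`: the commutator of `ε_u` and `ε'_{v,t}` in `PGL(2,K)`. -/
noncomputable def deltaC {K : Type*} [Field K] (u v t : K) : PGL2 K :=
  eps u * eps' v t * (eps u)⁻¹ * (eps' v t)⁻¹

/-- `μ_a`: the class in `PGL(2,K)` of the matrix `[[a, 0], [0, 1]]` (junk value `1` when
`a = 0`). -/
noncomputable def muA {K : Type*} [Field K] (a : K) : PGL2 K :=
  if h : a = 0 then 1 else pgl2 !![a, 0; 0, 1] (by simp [Matrix.det_fin_two_of, h])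

/-- `Γ(t)`: the subgroup of `PGL(2,K)` generated by the commutators `δ_{u,v,t}` for
`u, v ∈ F_q` (embedded in `K` via `i`); the Schottky group of the
Artin–Schreier–Mumford curve. -/
noncomputable def GammaASM {K : Type*} [Field K] {F : Type*} [Field F] [Fintype F]
    (i : F →+* K) (t : K) : Subgroup (PGL2 K) :=
  Subgroup.closure {g | ∃ u v : F, g = deltaC (i u) (i v) t}

/-- `N₁(t)`: the subgroup of `PGL(2,K)` generated by all `ε_u` and `ε'_{v,t}` for
`u, v ∈ F_q`. -/
noncomputable def N1ASM {K : Type*} [Field K] {F : Type*} [Field F] [Fintype F]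
    (i : F →+* K) (t : K) : Subgroup (PGL2 K) :=
  Subgroup.closure ({g | ∃ u : F, g = eps (i u)} ∪ {g | ∃ v : F, g = eps' (i v) t})

/-- `N₀(t)`: the subgroup of `PGL(2,K)` generated by `Γ(t)` together with the `ε'_{u,t}`. -/
noncomputable def N0ASM {K : Type*} [Field K] {F : Type*} [Field F] [Fintype F]
    (i : F →+* K) (t : K) : Subgroup (PGL2 K) :=
  GammaASM i t ⊔ Subgroup.closure {g | ∃ u : F, g = eps' (i u) t}

/-- `N(t)`: the subgroup of `PGL(2,K)` generated by the `ε_u`, `τ_t` and the `μ_a` for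
`a ∈ F_q^*`; the normalizer of the Schottky group `Γ(t)`. -/
noncomputable def NASM {K : Type*} [Field K] {F : Type*} [Field F] [Fintype F]
    (i : F →+* K) (t : K) : Subgroup (PGL2 K) :=
  Subgroup.closure
    ({g | ∃ u : F, g = eps (i u)} ∪ {tau t} ∪ {g | ∃ a : F, a ≠ 0 ∧ g = muA (i a)})

/-! ### Lifting to `SL(2,K)` -/

/-- Upper unipotent matrix in `SL(2,K)`. -/
def asmU {K : Type*} [Field K] (x : K) : Matrix.SpecialLinearGroup (Fin 2) K :=
  ⟨!![1, x; 0, 1], by simp [Matrix.det_fin_two_of]⟩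

/-- Lower unipotent matrix in `SL(2,K)`. -/
def asmL {K : Type*} [Field K] (x : K) : Matrix.SpecialLinearGroup (Fin 2) K :=
  ⟨!![1, 0; x, 1], by simp [Matrix.det_fin_two_of]⟩

/-- The projection from `SL(2,K)` to `PGL(2,K)`. -/
def asmPhi (K : Type*) [Field K] : Matrix.SpecialLinearGroup (Fin 2) K →* PGL2 K :=
  (QuotientGroup.mk' _).comp Matrix.SpecialLinearGroup.toGL

/-- The product of `U(a) L(b s)` over a list of pairs. -/
def asmW {K F : Type*} [Field K] [Field F] (i : F →+* K) (s : K) (l : List (F × F)) :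
    Matrix.SpecialLinearGroup (Fin 2) K :=
  (l.map fun x => asmU (i x.1) * asmL (i x.2 * s)).prod

/-- The lift of `Γ(t)` to `SL(2,K)`. -/
def asmG {K F : Type*} [Field K] [Field F] (i : F →+* K) (s : K) :
    Subgroup (Matrix.SpecialLinearGroup (Fin 2) K) :=
  Subgroup.closure {g | ∃ u v : F, g = asmU (i u) * asmL (i v * s) * (asmU (i u))⁻¹ *
    (asmL (i v * s))⁻¹}

/-- Trace of an element of `SL(2,K)`. -/
def asmTr {K : Type*} [Field K] (X : Matrix.SpecialLinearGroup (Fin 2) K) : K :=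
  Matrix.trace X.1

section basic
variable {K F : Type*} [Field K] [Field F]

theorem asmU_val (x : K) : (asmU x).1 = !![1, x; 0, 1] := rfl

theorem asmL_val (x : K) : (asmL x).1 = !![1, 0; x, 1] := rfl

theorem asmU_add (x y : K) : asmU (x + y) = asmU x * asmU y := by
  ext a b
  fin_cases a <;> fin_cases b <;>
    simp [asmU_val, Matrix.mul_apply, Fin.sum_univ_two, add_comm]

theorem asmL_add (x y : K) : asmL (x + y) = asmL x * asmL y := by
  ext a b
  fin_cases a <;> fin_cases b <;>
    simp [asmL_val, Matrix.mul_apply, Fin.sum_univ_two]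

theorem asmU_zero : asmU (0 : K) = 1 := by
  ext a b
  fin_cases a <;> fin_cases b <;> simp [asmU]

theorem asmL_zero : asmL (0 : K) = 1 := by
  ext a b
  fin_cases a <;> fin_cases b <;> simp [asmL]

theorem asmU_neg (x : K) : asmU (-x) = (asmU x)⁻¹ := by
  rw [eq_inv_iff_mul_eq_one, ← asmU_add, neg_add_cancel, asmU_zero]

theorem asmL_neg (x : K) : asmL (-x) = (asmL x)⁻¹ := by
  rw [eq_inv_iff_mul_eq_one, ← asmL_add, neg_add_cancel, asmL_zero]

theorem asmTr_comm (X Y : Matrix.SpecialLinearGroup (Fin 2) K) :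
    asmTr (X * Y) = asmTr (Y * X) := by
  simp only [asmTr, Matrix.SpecialLinearGroup.coe_mul]
  exact Matrix.trace_mul_comm _ _

theorem asm_mk_eq {X Y : Matrix.GeneralLinearGroup (Fin 2) K} :
    ((X : PGL2 K) = (Y : PGL2 K)) ↔ ∃ c : K, (Y.1 : Matrix (Fin 2) (Fin 2) K) = c • X.1 := by
  rw [QuotientGroup.eq, Matrix.GeneralLinearGroup.mem_center_iff_val_mem_range_scalar]
  constructor
  · rintro ⟨c, hc⟩
    refine ⟨c, ?_⟩
    have : Y = X * (X⁻¹ * Y) := by group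
    rw [this, Units.val_mul, ← hc]
    ext a b
    simp [Matrix.mul_apply, Matrix.scalar_apply, Matrix.diagonal_apply, mul_comm]
  · rintro ⟨c, hc⟩
    refine ⟨c, ?_⟩
    rw [Units.val_mul, hc, Matrix.mul_smul, ← Units.val_mul, inv_mul_cancel]
    ext a b
    simp [Matrix.scalar_apply, Matrix.diagonal_apply, Matrix.one_apply]

theorem asmPhi_U (x : K) : eps x = asmPhi K (asmU x) := by
  unfold eps pgl2 asmPhi
  simp only [MonoidHom.comp_apply, QuotientGroup.mk'_apply]
  congr 1
  ext a b
  simp [asmU_val, Matrix.GeneralLinearGroup.mkOfDetNeZero, Matrix.SpecialLinearGroup.toGL]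

theorem asmPhi_L (v t : K) (ht : t ≠ 0) : eps' v t = asmPhi K (asmL (v * t⁻¹)) := by
  unfold eps' tau eps pgl2 asmPhi
  simp only [MonoidHom.comp_apply, QuotientGroup.mk'_apply, dif_neg ht, ← QuotientGroup.mk_mul]
  rw [asm_mk_eq]
  refine ⟨t⁻¹, ?_⟩
  ext a b
  fin_cases a <;> fin_cases b <;>
  simp [asmL_val, Matrix.GeneralLinearGroup.mkOfDetNeZero, Matrix.SpecialLinearGroup.toGL,
    Matrix.mul_apply, Fin.sum_univ_two, ht, mul_comm]

theorem asmGamma_eq [Fintype F] (i : F →+* K) (t : K) (ht : t ≠ 0) :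
    GammaASM i t = (asmG i t⁻¹).map (asmPhi K) := by
  unfold GammaASM asmG
  rw [MonoidHom.map_closure]
  congr 1
  ext g
  simp only [Set.mem_ofPred_eq, Set.mem_image]
  have key : ∀ u v : F, deltaC (i u) (i v) t = asmPhi K (asmU (i u) * asmL (i v * t⁻¹) *
      (asmU (i u))⁻¹ * (asmL (i v * t⁻¹))⁻¹) := by
    intro u v
    simp only [deltaC, asmPhi_U, asmPhi_L _ _ ht, map_mul, map_inv]
  constructor
  · rintro ⟨u, v, rfl⟩
    exact ⟨_, ⟨u, v, rfl⟩, (key u v).symm⟩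
  · rintro ⟨_, ⟨u, v, rfl⟩, rfl⟩
    exact ⟨u, v, (key u v).symm⟩

theorem asm_conj_trace [Fintype F] (i : F →+* K) (t₁ t₂ : K) (h1 : t₁ ≠ 0) (h2 : t₂ ≠ 0)
    (g : PGL2 K)
    (h : Subgroup.map (MulAut.conj g).toMonoidHom (GammaASM i t₁) ≤ GammaASM i t₂)
    (X : Matrix.SpecialLinearGroup (Fin 2) K) (hX : X ∈ asmG i t₁⁻¹) :
    ∃ Y ∈ asmG i t₂⁻¹, asmTr X = asmTr Y ∨ asmTr X = - asmTr Y := by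
  rw [asmGamma_eq i t₁ h1, asmGamma_eq i t₂ h2] at h
  have hm := h (Subgroup.mem_map_of_mem _ (Subgroup.mem_map_of_mem (asmPhi K) hX))
  obtain ⟨Y, hY, hYX⟩ := hm
  refine ⟨Y, hY, ?_⟩
  obtain ⟨G, rfl⟩ := QuotientGroup.mk_surjective g
  have e : ((Matrix.SpecialLinearGroup.toGL Y : Matrix.GeneralLinearGroup (Fin 2) K) : PGL2 K)
      = ((G * Matrix.SpecialLinearGroup.toGL X * G⁻¹ : Matrix.GeneralLinearGroup (Fin 2) K) :
        PGL2 K) := by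
    simpa [asmPhi] using hYX
  rw [asm_mk_eq] at e
  obtain ⟨c, hc⟩ := e
  have hYc : (Matrix.SpecialLinearGroup.toGL Y).1 = Y.1 := rfl
  have hXc : (Matrix.SpecialLinearGroup.toGL X).1 = X.1 := rfl
  rw [hYc, Units.val_mul, Units.val_mul, hXc] at hc
  have hGG : (G⁻¹).1 * G.1 = 1 := by rw [← Units.val_mul]; simp
  have htr : X.1.trace = c * Y.1.trace := by
    have := congrArg Matrix.trace hc
    rw [Matrix.trace_mul_comm, ← Matrix.mul_assoc, hGG, one_mul, Matrix.trace_smul] at this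
    simpa using this
  have hdet : c ^ 2 = 1 := by
    have := congrArg Matrix.det hc
    rw [Matrix.det_mul_comm, ← Matrix.mul_assoc, hGG, one_mul, Matrix.det_smul, X.2, Y.2] at this
    simpa using this.symm
  rcases sq_eq_sq_iff_eq_or_eq_neg.mp (hdet.trans (one_pow 2).symm) with rfl | rfl
  · left; simpa [asmTr] using htr
  · right; simpa [asmTr] using htr

theorem asmW_cons (i : F →+* K) (s : K) (x : F × F) (l : List (F × F)) :
    asmW i s (x :: l) = asmU (i x.1) * asmL (i x.2 * s) * asmW i s l := by
  simp [asmW]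

theorem asmW_append (i : F →+* K) (s : K) (l l' : List (F × F)) :
    asmW i s (l ++ l') = asmW i s l * asmW i s l' := by
  simp [asmW]

theorem asmW_nil (i : F →+* K) (s : K) : asmW i s [] = 1 := by
  simp [asmW]

theorem asmG_word (i : F →+* K) (s : K) (X : Matrix.SpecialLinearGroup (Fin 2) K)
    (hX : X ∈ asmG i s) : ∃ l l' : List (F × F), l.sum = 0 ∧ l'.sum = 0 ∧ X = asmW i s l ∧
      X⁻¹ = asmW i s l' := by
  unfold asmG at hX
  induction hX using Subgroup.closure_induction with
  | mem x hx =>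
    obtain ⟨u, v, rfl⟩ := hx
    refine ⟨[(u, v), (-u, -v)], [(0, v), (u, -v), (-u, 0)], ?_, ?_, ?_, ?_⟩
    · simp
    · simp
    · simp [asmW_cons, asmW_nil, asmU_neg, asmL_neg, mul_assoc]
    · simp [asmW_cons, asmW_nil, asmU_neg, asmL_neg, mul_assoc, asmU_zero, asmL_zero]
  | one => exact ⟨[], [], by simp [asmW_nil]⟩
  | mul x y _ _ hx hy =>
    obtain ⟨l, l', h1, h2, h3, h4⟩ := hx
    obtain ⟨m, m', k1, k2, k3, k4⟩ := hy
    refine ⟨l ++ m, m' ++ l', by simp [h1, k1], by simp [h2, k2], ?_, ?_⟩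
    · rw [asmW_append, ← h3, ← k3]
    · rw [asmW_append, ← h4, ← k4, mul_inv_rev]
  | inv x _ hx =>
    obtain ⟨l, l', h1, h2, h3, h4⟩ := hx
    exact ⟨l', l, h2, h1, h4, by rw [inv_inv]; exact h3⟩

/-- Cyclic reduction. -/
theorem asm_reduce (i : F →+* K) (s : K) : ∀ n : ℕ, ∀ l : List (F × F), l.length = n →
    l.sum = 0 → asmTr (asmW i s l) = 2 ∨
      ∃ l' : List (F × F), 2 ≤ l'.length ∧ l'.sum = 0 ∧ (∀ x ∈ l', x.1 ≠ 0 ∧ x.2 ≠ 0) ∧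
        asmTr (asmW i s l) = asmTr (asmW i s l') := by
  have one : asmTr (1 : Matrix.SpecialLinearGroup (Fin 2) K) = 2 := by
    simp [asmTr]
  intro n
  induction n with
  | zero =>
    intro l hl _
    rw [List.length_eq_zero_iff] at hl
    subst hl
    left
    rw [asmW_nil, one]
  | succ n ih =>
    intro l hl hs
    by_cases hz : ∀ x ∈ l, x.1 ≠ 0 ∧ x.2 ≠ 0
    · right
      refine ⟨l, ?_, hs, hz, rfl⟩
      match l, hl, hs, hz with
      | [x], _, hs, hz =>
        exfalso
        simp at hs
        exact (hz x (by simp)).1 (by simp [hs])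
      | x :: y :: l, _, _, _ => simp
    · push Not at hz
      obtain ⟨x, hx, hx0⟩ := hz
      obtain ⟨l₁, l₂, rfl⟩ := List.append_of_mem hx
      have hrot : asmTr (asmW i s (l₁ ++ x :: l₂)) = asmTr (asmW i s (x :: (l₂ ++ l₁))) := by
        rw [← List.cons_append, asmW_append, asmTr_comm, ← asmW_append]
      have hsum : x + (l₂ ++ l₁).sum = 0 := by
        rw [← hs]; simp; abel
      have hlen : (l₂ ++ l₁).length = n := by
        simp at hl ⊢; omega
      rw [hrot]
      generalize l₂ ++ l₁ = m at hsum hlen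
      by_cases hx1 : x.1 = 0
      · rcases List.eq_nil_or_concat m with rfl | ⟨m', y, rfl⟩
        · left
          have : x = 0 := by simpa using hsum
          rw [asmW_cons, asmW_nil, this]
          simp [asmU_zero, asmL_zero, one]
        · have e : asmTr (asmW i s (x :: (m' ++ [y]))) =
              asmTr (asmW i s (m' ++ [(y.1, y.2 + x.2)])) := by
            rw [asmW_cons, asmTr_comm, asmW_append, asmW_append, asmW_cons, asmW_cons, asmW_nil]
            simp [hx1, asmU_zero, mul_assoc, add_mul, asmL_add]
          rw [List.concat_eq_append] at *
          rw [e]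
          apply ih
          · simpa using hlen
          · rw [← hsum]
            ext <;> simp [hx1] <;> ring
      · have hx2 := hx0 hx1
        match m, hsum, hlen with
        | [], hsum, _ =>
          exfalso
          have : x = 0 := by simpa using hsum
          exact hx1 (by simp [this])
        | y :: m', hsum, hlen =>
          have e : asmW i s (x :: y :: m') = asmW i s ((x.1 + y.1, y.2) :: m') := by
            simp [asmW_cons, hx2, asmL_zero, asmU_add, mul_assoc]
          rw [e]
          apply ih
          · simpa using hlen
          · rw [← hsum]
            ext <;> simp [hx2] <;> ring

theorem asmTr_two (i : F →+* K) (s : K) (x y : F × F) :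
    asmTr (asmW i s [x, y]) = (1 + i x.1 * (i x.2 * s)) * (1 + i y.1 * (i y.2 * s)) +
      i x.1 * (i y.2 * s) + i x.2 * s * i y.1 + 1 := by
  simp [asmTr, asmW, asmU_val, asmL_val, Matrix.trace_fin_two, Matrix.mul_apply, Fin.sum_univ_two]
  ring

theorem asmTr_comm_elt (i : F →+* K) (s : K) (u v : F) :
    asmTr (asmU (i u) * asmL (i v * s) * (asmU (i u))⁻¹ * (asmL (i v * s))⁻¹) =
      2 + (i u * i v * s) ^ 2 := by
  rw [← asmU_neg, ← asmL_neg]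
  simp [asmTr, asmU_val, asmL_val, Matrix.trace_fin_two, Matrix.mul_apply, Fin.sum_univ_two]
  ring

theorem asmTr_three (i : F →+* K) (s : K) (h3 : (3 : K) = 0) (x : F × F) :
    asmTr (asmW i s [x, x, x]) = (i x.1 * i x.2 * s) ^ 3 - 1 := by
  simp [asmTr, asmW, asmU_val, asmL_val, Matrix.trace_fin_two, Matrix.mul_apply, Fin.sum_univ_two]
  generalize i x.1 = a
  generalize i x.2 = b
  linear_combination (1 + 3 * (a * b * s) + 2 * (a * b * s) ^ 2) * h3

theorem asm_three_mem (i : F →+* K) (s : K) (h3 : (3 : F) = 0) :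
    asmW i s [(1, 1), (1, 1), (1, 1)] ∈ asmG i s := by
  have hU : asmU (i (-1)) = (asmU (i 1)) * asmU (i 1) := by
    rw [← asmU_add, ← map_add]; congr 2; linear_combination -h3
  have hL : asmL (i (-1) * s) = (asmL (i 1 * s)) * asmL (i 1 * s) := by
    rw [← asmL_add, ← add_mul, ← map_add]; congr 3; linear_combination -h3
  have hU' : asmU (i 1) = (asmU (i (-1)))⁻¹ := by simp [asmU_neg]
  have hL' : asmL (i 1 * s) = (asmL (i (-1) * s))⁻¹ := by simp [asmL_neg]
  have e : asmW i s [(1, 1), (1, 1), (1, 1)] =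
      (asmU (i 1) * asmL (i 1 * s) * (asmU (i 1))⁻¹ * (asmL (i 1 * s))⁻¹) *
      (asmU (i (-1)) * asmL (i 1 * s) * (asmU (i (-1)))⁻¹ * (asmL (i 1 * s))⁻¹)⁻¹ *
      (asmU (i (-1)) * asmL (i (-1) * s) * (asmU (i (-1)))⁻¹ * (asmL (i (-1) * s))⁻¹) := by
    have e1 : asmW i s [(1, 1), (1, 1), (1, 1)] = asmU (i 1) * asmL (i 1 * s) * asmU (i 1) *
      asmL (i 1 * s) * (asmU (i (-1)))⁻¹ * (asmL (i (-1) * s))⁻¹ := by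
      rw [← hU', ← hL']
      simp [asmW_cons, asmW_nil, mul_assoc]
    rw [e1, hU, hL]
    group
  have hm : ∀ u v : F, (asmU (i u) * asmL (i v * s) * (asmU (i u))⁻¹ * (asmL (i v * s))⁻¹) ∈
      asmG i s := fun u v => Subgroup.subset_closure ⟨u, v, rfl⟩
  rw [e]
  exact mul_mem (mul_mem (hm _ _) (inv_mem (hm _ _))) (hm _ _)

end basic

section normed
variable {K F : Type*} [NormedField K] [IsUltrametricDist K] [Field F] [Fintype F]

theorem asm_norm_one (i : F →+* K) (u : F) (hu : u ≠ 0) : ‖i u‖ = 1 := by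
  apply IsOfFinOrder.norm_eq_one
  rw [isOfFinOrder_iff_pow_eq_one]
  refine ⟨Fintype.card F - 1, ?_, ?_⟩
  · have := Fintype.one_lt_card (α := F); omega
  · rw [← map_pow, FiniteField.pow_card_sub_one_eq_one u hu, map_one]

theorem asm_norm_le (i : F →+* K) (u : F) : ‖i u‖ ≤ 1 := by
  by_cases hu : u = 0
  · simp [hu]
  · exact (asm_norm_one i u hu).le

theorem asm_add_le {x y : K} {r : ℝ} (hx : ‖x‖ ≤ r) (hy : ‖y‖ ≤ r) : ‖x + y‖ ≤ r :=
  (IsUltrametricDist.norm_add_le_max x y).trans (max_le hx hy)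

theorem asm_add_eq {x y : K} (h : ‖y‖ < ‖x‖) : ‖x + y‖ = ‖x‖ := by
  rw [IsUltrametricDist.norm_add_eq_max_of_norm_ne_norm h.ne', max_eq_left h.le]

theorem asm_entries (i : F →+* K) (s : K) (hs : 1 < ‖s‖) (l : List (F × F))
    (hl : ∀ x ∈ l, x.1 ≠ 0 ∧ x.2 ≠ 0) :
    ‖(asmW i s l).1 0 0‖ = ‖s‖ ^ l.length ∧ ‖(asmW i s l).1 1 0‖ ≤ ‖s‖ ^ l.length ∧
    ‖s‖ * ‖(asmW i s l).1 0 1‖ ≤ ‖s‖ ^ l.length ∧ ‖(asmW i s l).1 1 1‖ ≤ ‖s‖ ^ l.length ∧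
    (l ≠ [] → ‖s‖ * ‖(asmW i s l).1 1 1‖ ≤ ‖s‖ ^ l.length) := by
  induction l with
  | nil => simp [asmW_nil]
  | cons x l ih =>
    obtain ⟨hA, hC, hB, hD, -⟩ := ih (fun y hy => hl y (List.mem_cons_of_mem _ hy))
    obtain ⟨ha0, hb0⟩ := hl x (by simp)
    have ha := asm_norm_one i _ ha0
    have hb := asm_norm_one i _ hb0
    set M := (asmW i s l).1 with hM
    set r := ‖s‖ with hr
    set P := r ^ l.length with hP
    have hPpos : 0 < P := by positivity
    have hPlt : P < r * P := by nlinarith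
    have e00 : (asmW i s (x :: l)).1 0 0 =
        i x.1 * (i x.2 * s * M 0 0) + (M 0 0 + i x.1 * M 1 0) := by
      rw [asmW_cons]
      simp [asmU_val, asmL_val, Matrix.mul_apply, Fin.sum_univ_two, ← hM]
      ring
    have e01 : (asmW i s (x :: l)).1 0 1 =
        i x.1 * (i x.2 * s * M 0 1) + (M 0 1 + i x.1 * M 1 1) := by
      rw [asmW_cons]
      simp [asmU_val, asmL_val, Matrix.mul_apply, Fin.sum_univ_two, ← hM]
      ring
    have e10 : (asmW i s (x :: l)).1 1 0 = i x.2 * s * M 0 0 + M 1 0 := by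
      rw [asmW_cons]
      simp [asmU_val, asmL_val, Matrix.mul_apply, Fin.sum_univ_two, ← hM]
    have e11 : (asmW i s (x :: l)).1 1 1 = i x.2 * s * M 0 1 + M 1 1 := by
      rw [asmW_cons]
      simp [asmU_val, asmL_val, Matrix.mul_apply, Fin.sum_univ_two, ← hM]
    have hpow : r ^ (x :: l).length = r * P := by
      rw [List.length_cons, pow_succ, mul_comm]
    have hB' : ‖M 0 1‖ ≤ P := by
      have : 0 ≤ ‖M 0 1‖ := norm_nonneg _
      nlinarith
    have n00 : ‖i x.1 * (i x.2 * s * M 0 0)‖ = r * P := by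
      rw [norm_mul, norm_mul, norm_mul, ha, hb, hA]; ring
    have n11 : ‖(asmW i s (x :: l)).1 1 1‖ ≤ P := by
      rw [e11]
      refine asm_add_le ?_ hD
      rw [norm_mul, norm_mul, hb, one_mul]; exact hB
    have n01 : ‖(asmW i s (x :: l)).1 0 1‖ ≤ P := by
      rw [e01]
      refine asm_add_le ?_ (asm_add_le hB' ?_)
      · rw [norm_mul, norm_mul, norm_mul, hb, ha, one_mul, one_mul]; exact hB
      · rw [norm_mul, ha, one_mul]; exact hD
    have hr0 : 0 ≤ r := norm_nonneg _
    rw [hpow]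
    refine ⟨?_, ?_, ?_, ?_, ?_⟩
    · rw [e00, asm_add_eq, n00]
      rw [n00]
      refine lt_of_le_of_lt (asm_add_le hA.le ?_) hPlt
      rw [norm_mul, ha, one_mul]; exact hC
    · rw [e10]
      refine asm_add_le ?_ (hC.trans hPlt.le)
      rw [norm_mul, norm_mul, hb, one_mul, hA]
    · exact mul_le_mul_of_nonneg_left n01 hr0
    · exact n11.trans hPlt.le
    · intro _
      exact mul_le_mul_of_nonneg_left n11 hr0

theorem asm_trace_norm (i : F →+* K) (s : K) (hs : 1 < ‖s‖) (l : List (F × F))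
    (hl : ∀ x ∈ l, x.1 ≠ 0 ∧ x.2 ≠ 0) (hne : l ≠ []) :
    ‖asmTr (asmW i s l)‖ = ‖s‖ ^ l.length := by
  obtain ⟨hA, -, -, -, hD⟩ := asm_entries i s hs l hl
  have hD := hD hne
  rw [asmTr, Matrix.trace_fin_two, asm_add_eq, hA]
  rw [hA]
  have : 0 < ‖s‖ ^ l.length := by positivity
  have : 0 ≤ ‖(asmW i s l).1 1 1‖ := norm_nonneg _
  by_contra hcon
  push Not at hcon
  nlinarith

theorem asm_two_le : ‖(2 : K)‖ ≤ 1 := by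
  have : (2 : K) = 1 + 1 := by norm_num
  rw [this]
  exact asm_add_le (by simp) (by simp)

theorem asm_four_le : ‖(4 : K)‖ ≤ 1 := by
  have : (4 : K) = 2 + 2 := by norm_num
  rw [this]
  exact asm_add_le asm_two_le asm_two_le

/-- An element of large trace is represented, up to trace, by a reduced word. -/
theorem asm_large (i : F →+* K) (s : K) (hs : 1 < ‖s‖)
    (X : Matrix.SpecialLinearGroup (Fin 2) K) (hX : X ∈ asmG i s) (hbig : 1 < ‖asmTr X‖) :
    ∃ l : List (F × F), 2 ≤ l.length ∧ l.sum = 0 ∧ (∀ x ∈ l, x.1 ≠ 0 ∧ x.2 ≠ 0) ∧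
        asmTr X = asmTr (asmW i s l) ∧ ‖asmTr X‖ = ‖s‖ ^ l.length := by
  obtain ⟨l, -, h1, -, rfl, -⟩ := asmG_word i s X hX
  rcases asm_reduce i s _ l rfl h1 with h | ⟨l', k1, k2, k3, k4⟩
  · rw [h] at hbig
    exact absurd hbig (not_lt.mpr asm_two_le)
  · refine ⟨l', k1, k2, k3, k4, ?_⟩
    rw [k4, asm_trace_norm i s hs l' k3]
    rintro rfl
    simp at k1

theorem asm_comm_norm (i : F →+* K) (s : K) (hs : 1 < ‖s‖) (c : F) (hc : c ≠ 0) :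
    ‖2 + (i c * i 1 * s) ^ 2‖ = ‖s‖ ^ 2 := by
  have h : ‖(i c * i 1 * s) ^ 2‖ = ‖s‖ ^ 2 := by
    rw [norm_pow, norm_mul, norm_mul, asm_norm_one i c hc]; simp
  rw [add_comm, asm_add_eq, h]
  rw [h]
  exact lt_of_le_of_lt asm_two_le (one_lt_pow₀ hs (by norm_num))

theorem asm_norm_cmp (i : F →+* K) (s₁ s₂ : K) (hs₁ : 1 < ‖s₁‖) (hs₂ : 1 < ‖s₂‖)
    (h : ∀ X ∈ asmG i s₁, ∃ Y ∈ asmG i s₂, asmTr X = asmTr Y ∨ asmTr X = - asmTr Y) :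
    ‖s₂‖ ≤ ‖s₁‖ := by
  obtain ⟨Y, hY, hXY⟩ := h _ (Subgroup.subset_closure ⟨1, 1, rfl⟩)
  rw [asmTr_comm_elt] at hXY
  have hn : ‖asmTr Y‖ = ‖s₁‖ ^ 2 := by
    rw [← asm_comm_norm i s₁ hs₁ 1 one_ne_zero]
    rcases hXY with h | h <;> rw [h]
    rw [norm_neg]
  have hbig : 1 < ‖asmTr Y‖ := by rw [hn]; exact one_lt_pow₀ hs₁ (by norm_num)
  obtain ⟨l, hl, -, -, -, hnorm⟩ := asm_large i s₂ hs₂ Y hY hbig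
  rw [hn] at hnorm
  have : ‖s₂‖ ^ 2 ≤ ‖s₁‖ ^ 2 := by
    rw [hnorm]; exact pow_le_pow_right₀ hs₂.le hl
  exact le_of_sq_le_sq this (norm_nonneg _)

theorem asm_pair (i : F →+* K) (s₁ s₂ : K) (hs₁ : 1 < ‖s₁‖) (hs : ‖s₁‖ = ‖s₂‖)
    (h : ∀ X ∈ asmG i s₁, ∃ Y ∈ asmG i s₂, asmTr X = asmTr Y ∨ asmTr X = - asmTr Y)
    (c : F) (hc : c ≠ 0) : ∃ d : F, d ≠ 0 ∧
      (2 + (i c * s₁) ^ 2 = 2 + (i d * s₂) ^ 2 ∨ 2 + (i c * s₁) ^ 2 = -(2 + (i d * s₂) ^ 2)) := by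
  obtain ⟨Y, hY, hXY⟩ := h _ (Subgroup.subset_closure ⟨c, 1, rfl⟩)
  rw [asmTr_comm_elt] at hXY
  have hn : ‖asmTr Y‖ = ‖s₁‖ ^ 2 := by
    rw [← asm_comm_norm i s₁ hs₁ c hc]
    rcases hXY with h | h <;> rw [h]
    rw [norm_neg]
  have hbig : 1 < ‖asmTr Y‖ := by rw [hn]; exact one_lt_pow₀ hs₁ (by norm_num)
  have hs₂ : 1 < ‖s₂‖ := hs ▸ hs₁
  obtain ⟨l, hl, hsum, hnz, htr, hnorm⟩ := asm_large i s₂ hs₂ Y hY hbig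
  rw [hn, hs] at hnorm
  have hlen : l.length = 2 := (pow_right_injective₀ (by linarith) hs₂.ne' hnorm).symm
  obtain ⟨x, y, rfl⟩ := List.length_eq_two.mp hlen
  have hy : y = -x := by
    have : x + y = 0 := by simpa using hsum
    exact (neg_eq_of_add_eq_zero_right this).symm
  have hx := hnz x (by simp)
  have htr' : asmTr Y = 2 + (i (x.1 * x.2) * s₂) ^ 2 := by
    rw [htr, asmTr_two, hy]
    simp
    ring
  refine ⟨x.1 * x.2, mul_ne_zero hx.1 hx.2, ?_⟩
  rw [← htr']
  simpa using hXY

theorem asm_triple (i : F →+* K) (s₁ s₂ : K) (hs₁ : 1 < ‖s₁‖) (hs : ‖s₁‖ = ‖s₂‖)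
    (h : ∀ X ∈ asmG i s₁, ∃ Y ∈ asmG i s₂, asmTr X = asmTr Y ∨ asmTr X = - asmTr Y)
    (h3 : (3 : F) = 0) (hF : ∀ c : F, c ≠ 0 → c = 1 ∨ c = -1) : ∃ e : F, (e = 1 ∨ e = -1) ∧
      (s₁ ^ 3 - 1 = (i e * s₂) ^ 3 - 1 ∨ s₁ ^ 3 - 1 = -((i e * s₂) ^ 3 - 1)) := by
  have h3K : (3 : K) = 0 := by
    rw [← map_ofNat i 3, h3, map_zero]
  obtain ⟨Y, hY, hXY⟩ := h _ (asm_three_mem i s₁ h3)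
  have hs₂ : 1 < ‖s₂‖ := hs ▸ hs₁
  have hn : ‖asmTr Y‖ = ‖s₁‖ ^ 3 := by
    have := asm_trace_norm i s₁ hs₁ [(1, 1), (1, 1), (1, 1)] (by simp) (by simp)
    simp only [List.length_cons, List.length_nil] at this
    rw [← this]
    rcases hXY with h | h <;> rw [h]
    rw [norm_neg]
  have hbig : 1 < ‖asmTr Y‖ := by rw [hn]; exact one_lt_pow₀ hs₁ (by norm_num)
  obtain ⟨l, hl, hsum, hnz, htr, hnorm⟩ := asm_large i s₂ hs₂ Y hY hbig
  rw [hn, hs] at hnorm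
  have hlen : l.length = 3 := (pow_right_injective₀ (by linarith) hs₂.ne' hnorm).symm
  obtain ⟨x, y, z, rfl⟩ := List.length_eq_three.mp hlen
  have key : ∀ a b c : F, a ≠ 0 → b ≠ 0 → c ≠ 0 → a + (b + c) = 0 → b = a ∧ c = a := by
    intro a b c ha hb hc habc
    have h1 : (1 : F) ≠ 0 := one_ne_zero
    rcases hF a ha with rfl | rfl <;> rcases hF b hb with rfl | rfl <;>
      rcases hF c hc with rfl | rfl
    · exact ⟨rfl, rfl⟩
    · exact absurd (by linear_combination habc) h1
    · exact absurd (by linear_combination habc) h1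
    · exact absurd (by linear_combination -habc) h1
    · exact absurd (by linear_combination habc) h1
    · exact absurd (by linear_combination -habc) h1
    · exact absurd (by linear_combination -habc) h1
    · exact ⟨rfl, rfl⟩
  have hx := hnz x (by simp)
  have hy := hnz y (by simp)
  have hz := hnz z (by simp)
  have hsum' : x + (y + z) = 0 := by simpa using hsum
  have k1 := key _ _ _ hx.1 hy.1 hz.1 (by simpa using congrArg Prod.fst hsum')
  have k2 := key _ _ _ hx.2 hy.2 hz.2 (by simpa using congrArg Prod.snd hsum')
  obtain rfl : y = x := Prod.ext k1.1 k2.1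
  obtain rfl : z = y := Prod.ext k1.2 k2.2
  refine ⟨z.1 * z.2, hF _ (mul_ne_zero hx.1 hx.2), ?_⟩
  rw [htr, asmTr_three i s₁ h3K, asmTr_three i s₂ h3K] at hXY
  simpa using hXY

theorem asm_final (i : F →+* K) (s₁ s₂ : K) (hs₁ : 1 < ‖s₁‖) (hs : ‖s₁‖ = ‖s₂‖)
    (h : ∀ X ∈ asmG i s₁, ∃ Y ∈ asmG i s₂, asmTr X = asmTr Y ∨ asmTr X = - asmTr Y) :
    ∃ d : F, d ≠ 0 ∧ s₁ = i d * s₂ := by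
  have hs₂ : 1 < ‖s₂‖ := hs ▸ hs₁
  -- the good sign suffices
  have good : ∀ d : F, d ≠ 0 → s₁ ^ 2 = (i d * s₂) ^ 2 → ∃ d : F, d ≠ 0 ∧ s₁ = i d * s₂ := by
    intro d hd hh
    rcases sq_eq_sq_iff_eq_or_eq_neg.mp hh with h | h
    · exact ⟨d, hd, h⟩
    · exact ⟨-d, neg_ne_zero.mpr hd, by rw [h, map_neg, neg_mul]⟩
  obtain ⟨d, hd, hh⟩ := asm_pair i s₁ s₂ hs₁ hs h 1 one_ne_zero
  rw [map_one, one_mul] at hh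
  rcases hh with hh | hh
  · exact good d hd (by linear_combination hh)
  by_cases h2 : (2 : F) = 0
  · have h2K : (2 : K) = 0 := by rw [← map_ofNat i 2, h2, map_zero]
    exact good d hd (by linear_combination hh + (-2 - (i d * s₂) ^ 2) * h2K)
  exfalso
  have small : ∀ k : F, i k * s₂ ^ 2 ≠ -4 := by
    intro k hk
    by_cases hk0 : k = 0
    · rw [hk0, map_zero, zero_mul] at hk
      have : i (2 * 2) = 0 := by rw [map_mul, map_ofNat]; linear_combination hk
      rw [map_eq_zero] at this
      rcases mul_eq_zero.mp this with h | h <;> exact h2 h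
    · have := congrArg norm hk
      rw [norm_mul, asm_norm_one i k hk0, one_mul, norm_neg, norm_pow] at this
      have h4 := asm_four_le (K := K)
      have := one_lt_pow₀ hs₂ (two_ne_zero)
      linarith
  have small' : ∀ k l : F, k ≠ 0 → i k * s₁ ^ 2 ≠ i l * s₂ ^ 2 := by
    intro k l hk hkl
    have hik : i k ≠ 0 := (map_ne_zero i).mpr hk
    apply small (k⁻¹ * l + d ^ 2)
    simp only [map_add, map_mul, map_inv₀, map_pow]
    have : (i k)⁻¹ * i l * s₂ ^ 2 = s₁ ^ 2 := by
      rw [mul_assoc, ← hkl, ← mul_assoc, inv_mul_cancel₀ hik, one_mul]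
    linear_combination this + hh
  have hF : ∀ c : F, c ≠ 0 → c = 1 ∨ c = -1 := by
    intro c hc
    by_contra hcon
    have hc1 : c ^ 2 - 1 ≠ 0 := by
      intro h0
      exact hcon (sq_eq_sq_iff_eq_or_eq_neg.mp (by linear_combination h0))
    obtain ⟨e, he, hce⟩ := asm_pair i s₁ s₂ hs₁ hs h c hc
    rcases hce with hce | hce
    · apply small' (c ^ 2) (e ^ 2) (pow_ne_zero 2 hc)
      simp only [map_pow]
      linear_combination hce
    · apply small' (c ^ 2 - 1) (d ^ 2 - e ^ 2) hc1
      simp only [map_pow, map_sub, map_one]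
      linear_combination hce - hh
  have h3 : (3 : F) = 0 := by
    rcases hF 2 h2 with h | h
    · exact absurd (by linear_combination h) (one_ne_zero (α := F))
    · linear_combination h
  have h3K : (3 : K) = 0 := by rw [← map_ofNat i 3, h3, map_zero]
  obtain ⟨e, he, hte⟩ := asm_triple i s₁ s₂ hs₁ hs h h3 hF
  have hd2 : i d ^ 2 = 1 := by
    rcases hF d hd with rfl | rfl <;> simp
  have he2 : i e ^ 2 = 1 := by
    rcases he with rfl | rfl <;> simp
  rcases hte with hte | hte
  · have : (s₁ - i e * s₂) ^ 3 = 0 := by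
      linear_combination hte + (- s₁ ^ 2 * (i e * s₂) + s₁ * (i e * s₂) ^ 2) * h3K
    have := pow_eq_zero_iff (three_ne_zero) |>.mp this
    refine small' 1 (e ^ 2) one_ne_zero ?_
    simp only [map_one, map_pow]
    linear_combination (s₁ + i e * s₂) * this
  · have : (s₁ + i e * s₂ + 1) ^ 3 = 0 := by
      linear_combination hte + (s₁ ^ 2 * (i e * s₂) + s₁ * (i e * s₂) ^ 2 + 1 +
        (s₁ + i e * s₂) ^ 2 + (s₁ + i e * s₂)) * h3K
    have := pow_eq_zero_iff (three_ne_zero) |>.mp this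
    have h5 : (s₂ - i e) ^ 2 = 0 := by
      linear_combination (s₁ - i e * s₂ - 1) * this - hh + he2 + s₂ ^ 2 * hd2 + s₂ ^ 2 * he2 +
        (s₂ ^ 2 + 2) * h3K
    have h6 : s₂ = i e := by
      have := pow_eq_zero_iff (two_ne_zero) |>.mp h5
      exact sub_eq_zero.mp this
    rw [h6] at hs₂
    exact absurd hs₂ (not_lt.mpr (asm_norm_le i e))

end normed

/-- The Schottky groups `Γ(t₁)` and `Γ(t₂)` of two Artin–Schreier–Mumford curves, with
`0 < |t₁| < 1` and `0 < |t₂| < 1`, are conjugate subgroups of `PGL(2,K)` if and only if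
`t₁ = ζ t₂` for some nonzero `ζ ∈ F_q`. -/
theorem asm_schottky_conjugate_iff
    {p m : ℕ} (hp : p.Prime) (hm : 0 < m) {q : ℕ} (hq : q = p ^ m)
    {K : Type*} [NormedField K] [CompleteSpace K] [IsUltrametricDist K] [CharP K p]
    {F : Type*} [Field F] [Fintype F] (hF : Fintype.card F = q) (i : F →+* K)
    (t₁ t₂ : K) (h₁0 : 0 < ‖t₁‖) (h₁1 : ‖t₁‖ < 1) (h₂0 : 0 < ‖t₂‖) (h₂1 : ‖t₂‖ < 1) :
    (∃ g : PGL2 K,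
        Subgroup.map (MulAut.conj g).toMonoidHom (GammaASM i t₁) = GammaASM i t₂)
      ↔ ∃ ζ : F, ζ ≠ 0 ∧ t₁ = i ζ * t₂ := by
  have ht₁ : t₁ ≠ 0 := norm_pos_iff.mp h₁0
  have ht₂ : t₂ ≠ 0 := norm_pos_iff.mp h₂0
  constructor
  · rintro ⟨g, hg⟩
    have hs₁ : 1 < ‖t₁⁻¹‖ := by rw [norm_inv]; exact (one_lt_inv₀ h₁0).mpr h₁1
    have hs₂ : 1 < ‖t₂⁻¹‖ := by rw [norm_inv]; exact (one_lt_inv₀ h₂0).mpr h₂1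
    have hA := asm_conj_trace i t₁ t₂ ht₁ ht₂ g hg.le
    have hB := asm_conj_trace i t₂ t₁ ht₂ ht₁ g⁻¹ (by
      rw [← hg, Subgroup.map_map]
      rintro _ ⟨x, hx, rfl⟩
      simpa [mul_assoc] using hx)
    have hn := le_antisymm (asm_norm_cmp i _ _ hs₂ hs₁ hB) (asm_norm_cmp i _ _ hs₁ hs₂ hA)
    obtain ⟨d, hd, h⟩ := asm_final i _ _ hs₁ hn hA
    refine ⟨d⁻¹, inv_ne_zero hd, ?_⟩
    rw [← inv_inv t₁, h, mul_inv, inv_inv, map_inv₀]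
  · rintro ⟨ζ, hζ, rfl⟩
    have hiζ : i ζ ≠ 0 := (map_ne_zero i).mpr hζ
    refine ⟨1, ?_⟩
    have e : (MulAut.conj (1 : PGL2 K)).toMonoidHom = MonoidHom.id _ := by
      ext x; simp
    rw [e, Subgroup.map_id, asmGamma_eq i _ ht₁, asmGamma_eq i _ ht₂]
    refine congrArg (Subgroup.map (asmPhi K)) ?_
    unfold asmG
    refine congrArg Subgroup.closure ?_
    ext X
    constructor
    · rintro ⟨u, v, rfl⟩
      refine ⟨u, v * ζ⁻¹, ?_⟩
      simp only [map_mul, map_inv₀, mul_inv, mul_assoc]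
    · rintro ⟨u, v, rfl⟩
      refine ⟨u, v * ζ, ?_⟩
      have : i (v * ζ) * (i ζ * t₂)⁻¹ = i v * t₂⁻¹ := by
        rw [map_mul]; field_simp
      rw [this]
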